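/- arXiv:2003.02466 — 5 statements merged into one kernel-verified Lean document; each statement's English description precedes it below -/
import Mathlib

section
/- Let N ≥ 2 be an integer. For every α ∈ [0, π), one has N·cos α · ∫_α^π (sin θ)^N dθ + (sin α)^{N+1} > 0. -/
open Real

theorem integral_sin_pow_mul_cos (n : ℕ) (a b : ℝ) :
    ((n : ℝ) + 1) * (∫ θ in a..b, sin θ ^ n * cos θ) = sin b ^ (n + 1) - sin a ^ (n + 1) := by
  rw [← intervalIntegral.integral_const_mul,
    intervalIntegral.integral_eq_sub_of_hasDerivAt (f := fun θ => sin θ ^ (n + 1))]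
  · intro θ _
    refine ((hasDerivAt_sin θ).fun_pow (n + 1)).congr_deriv ?_
    simp [mul_assoc]
  · exact Continuous.intervalIntegrable (by fun_prop) _ _

theorem stmt_4 (N : ℕ) (hN : 2 ≤ N) (α : ℝ) (hα : α ∈ Set.Ico 0 π) :
    (N : ℝ) * cos α * (∫ θ in α..π, sin θ ^ N) + sin α ^ (N + 1) > 0 := by
  obtain ⟨h0, hπ⟩ := hα
  have hN0 : (0 : ℝ) < N := by exact_mod_cast (by omega : 0 < N)
  rcases h0.eq_or_lt with rfl | hpos
  · have := integral_sin_pow_pos (n := N)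
    simp only [cos_zero, sin_zero]
    positivity
  have hs : 0 < sin α ^ (N + 1) := pow_pos (sin_pos_of_pos_of_lt_pi hpos hπ) _
  have hsin : ∀ θ ∈ Set.Icc α π, 0 ≤ sin θ ^ N := fun θ hθ =>
    pow_nonneg (sin_nonneg_of_nonneg_of_le_pi (h0.trans hθ.1) hθ.2) _
  have hle : (∫ θ in α..π, sin θ ^ N * cos θ) ≤ cos α * ∫ θ in α..π, sin θ ^ N := by
    rw [← intervalIntegral.integral_const_mul]
    refine intervalIntegral.integral_mono_on hπ.le
      (Continuous.intervalIntegrable (by fun_prop) _ _)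
      (Continuous.intervalIntegrable (by fun_prop) _ _) fun θ hθ => ?_
    rw [mul_comm]
    exact mul_le_mul_of_nonneg_right (cos_le_cos_of_nonneg_of_le_pi h0 hθ.2 hθ.1) (hsin θ hθ)
  have hint := integral_sin_pow_mul_cos N α π
  rw [sin_pi, zero_pow N.succ_ne_zero, zero_sub] at hint
  have hneg : (∫ θ in α..π, sin θ ^ N * cos θ) < 0 := by
    by_contra! h
    have : 0 ≤ ((N : ℝ) + 1) * ∫ θ in α..π, sin θ ^ N * cos θ := by positivity
    linarith
  rw [mul_assoc]
  linarith [mul_le_mul_of_nonneg_left hle hN0.le]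
end

section
/- Let N ≥ 2 be an integer. The function L₁ defined on (0, π) by L₁(α) = (sin α)^N / ∫_α^π (sin θ)^N dθ is strictly increasing on (0, π). -/
open Real

theorem hasDerivAt_integral_sin_pow_left (n : ℕ) (b x : ℝ) :
    HasDerivAt (fun α : ℝ => ∫ θ in α..b, sin θ ^ n) (-sin x ^ n) x := by
  have hc : Continuous fun θ : ℝ => sin θ ^ n := by fun_prop
  exact intervalIntegral.integral_hasDerivAt_left (hc.intervalIntegrable _ _)
    (hc.stronglyMeasurableAtFilter _ _) hc.continuousAt

theorem integral_sin_pow_pos_of_mem_Ioo (n : ℕ) {x : ℝ} (hx : x ∈ Set.Ioo 0 π) :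
    0 < ∫ θ in x..π, sin θ ^ n := by
  have hc : Continuous fun θ : ℝ => sin θ ^ n := by fun_prop
  exact intervalIntegral.intervalIntegral_pos_of_pos_on (hc.intervalIntegrable _ _)
    (fun θ hθ => pow_pos (sin_pos_of_pos_of_lt_pi (hx.1.trans hθ.1) hθ.2) n) hx.2

theorem sin_pow_mul_cos_lt_mul_integral (m : ℕ) {x : ℝ} (hx : x ∈ Set.Ioo 0 π) :
    sin x ^ (m + 1) * cos x < (m + 2) * ∫ θ in x..π, sin θ ^ (m + 2) := by
  have hd (y : ℝ) : HasDerivAt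
      (fun y => sin y ^ (m + 1) * cos y - (m + 2) * ∫ θ in y..π, sin θ ^ (m + 2))
      ((m + 1) * sin y ^ m) y := by
    refine HasDerivAt.congr_deriv
      ((((hasDerivAt_sin y).fun_pow (m + 1)).fun_mul (hasDerivAt_cos y)).fun_sub
      ((hasDerivAt_integral_sin_pow_left (m + 2) π y).const_mul ((m : ℝ) + 2))) ?_
    simp only [Nat.add_sub_cancel]
    push_cast
    linear_combination ((m + 1) * sin y ^ m) * sin_sq_add_cos_sq y
  have hmono := strictMonoOn_of_deriv_pos (convex_Icc 0 π)
    (fun y _ => (hd y).continuousAt.continuousWithinAt) (fun y hy => by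
      rw [interior_Icc] at hy
      rw [(hd y).deriv]
      have := sin_pos_of_mem_Ioo hy
      positivity)
  have h := hmono (Set.Ioo_subset_Icc_self hx) (Set.right_mem_Icc.2 pi_pos.le) hx.2
  simp at h
  linarith

theorem mul_cos_mul_integral_add_sin_pow_pos (m : ℕ) {x : ℝ} (hx : x ∈ Set.Ioo 0 π) :
    0 < (m + 2) * cos x * (∫ θ in x..π, sin θ ^ (m + 2)) + sin x ^ (m + 3) := by
  have hd (y : ℝ) : HasDerivAt
      (fun y => (m + 2) * cos y * (∫ θ in y..π, sin θ ^ (m + 2)) + sin y ^ (m + 3))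
      (sin y * (sin y ^ (m + 1) * cos y - (m + 2) * ∫ θ in y..π, sin θ ^ (m + 2))) y := by
    refine HasDerivAt.congr_deriv ((((hasDerivAt_cos y).const_mul ((m : ℝ) + 2)).fun_mul
      (hasDerivAt_integral_sin_pow_left (m + 2) π y)).fun_add
      ((hasDerivAt_sin y).fun_pow (m + 3))) ?_
    simp only [show m + 3 - 1 = m + 2 from rfl]
    push_cast
    ring
  have hanti := strictAntiOn_of_deriv_neg (convex_Icc 0 π)
    (fun y _ => (hd y).continuousAt.continuousWithinAt) (fun y hy => by
      rw [interior_Icc] at hy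
      rw [(hd y).deriv]
      exact mul_neg_of_pos_of_neg (sin_pos_of_mem_Ioo hy)
        (sub_neg.2 (sin_pow_mul_cos_lt_mul_integral m hy)))
  have h := hanti (Set.Ioo_subset_Icc_self hx) (Set.right_mem_Icc.2 pi_pos.le) hx.2
  simpa using h

theorem stmt_6 (N : ℕ) (hN : 2 ≤ N) :
    StrictMonoOn (fun α : ℝ => sin α ^ N / ∫ θ in α..π, sin θ ^ N) (Set.Ioo 0 π) := by
  obtain ⟨m, rfl⟩ := Nat.exists_eq_add_of_le' hN
  have hd (y : ℝ) (hy : y ∈ Set.Ioo 0 π) :=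
    ((hasDerivAt_sin y).fun_pow (m + 2)).fun_div (hasDerivAt_integral_sin_pow_left (m + 2) π y)
      (integral_sin_pow_pos_of_mem_Ioo (m + 2) hy).ne'
  refine strictMonoOn_of_deriv_pos (convex_Ioo 0 π)
    (fun y hy => (hd y hy).continuousAt.continuousWithinAt) fun y hy => ?_
  rw [interior_Ioo] at hy
  rw [(hd y hy).deriv]
  refine div_pos ?_ (pow_pos (integral_sin_pow_pos_of_mem_Ioo (m + 2) hy) 2)
  convert mul_pos (pow_pos (sin_pos_of_mem_Ioo hy) (m + 1))
    (mul_cos_mul_integral_add_sin_pow_pos m hy) using 1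
  simp only [show m + 2 - 1 = m + 1 from rfl]
  push_cast
  ring
end

section
/- Let N ≥ 2 be an integer. For every α ∈ (0, π), one has (N−1)·cos α · ∫_α^π (sin θ)^{N−2} dθ + (sin α)^{N−1} > 0. -/
open Real

theorem integral_sin_pow_mul_cos_to_pi (m : ℕ) (α : ℝ) :
    ((m : ℝ) + 1) * ∫ θ in α..π, sin θ ^ m * cos θ = -sin α ^ (m + 1) := by
  rw [← intervalIntegral.integral_const_mul,
    intervalIntegral.integral_eq_sub_of_hasDerivAt (f := fun θ => sin θ ^ (m + 1))]
  · simp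
  · intro θ _
    refine ((hasDerivAt_sin θ).pow (m + 1)).congr_deriv ?_
    rw [Nat.add_sub_cancel, Nat.cast_succ, mul_assoc]
  · exact Continuous.intervalIntegrable (by fun_prop) _ _

theorem integral_sin_pow_mul_cos_sub_cos_pos (m : ℕ) {α : ℝ} (hα : α ∈ Set.Ioo 0 π) :
    0 < ∫ θ in α..π, sin θ ^ m * (cos α - cos θ) := by
  refine intervalIntegral.intervalIntegral_pos_of_pos_on
    (Continuous.intervalIntegrable (by fun_prop) _ _) (fun θ hθ => ?_) hα.2
  have hsin : 0 < sin θ := sin_pos_of_pos_of_lt_pi (hα.1.trans hθ.1) hθ.2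
  have hcos : cos θ < cos α := cos_lt_cos_of_nonneg_of_le_pi hα.1.le hθ.2.le hθ.1
  exact mul_pos (pow_pos hsin m) (sub_pos.2 hcos)

theorem stmt_10 (N : ℕ) (hN : 2 ≤ N) (α : ℝ) (hα : α ∈ Set.Ioo 0 π) :
    ((N : ℝ) - 1) * cos α * (∫ θ in α..π, sin θ ^ (N - 2)) + sin α ^ (N - 1) > 0 := by
  obtain ⟨m, rfl⟩ := Nat.exists_eq_add_of_le' hN
  have hsplit : ∫ θ in α..π, sin θ ^ m * (cos α - cos θ) =
      (∫ θ in α..π, sin θ ^ m) * cos α - ∫ θ in α..π, sin θ ^ m * cos θ := by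
    simp_rw [mul_sub]
    rw [intervalIntegral.integral_sub (Continuous.intervalIntegrable (by fun_prop) _ _)
      (Continuous.intervalIntegrable (by fun_prop) _ _), intervalIntegral.integral_mul_const]
  have hpos := mul_pos (by positivity : (0 : ℝ) < m + 1)
    (integral_sin_pow_mul_cos_sub_cos_pos m hα)
  rw [hsplit, mul_sub, integral_sin_pow_mul_cos_to_pi] at hpos
  rw [show m + 2 - 2 = m by omega, show m + 2 - 1 = m + 1 by omega]
  push_cast
  linarith
end

section
/- Let N ≥ 2 be an integer, let ρ₋, ρ₊, V₋, V₊, ω, γ > 0. For (α, β) ∈ (0, π)², define R₋(α) = (V₋/(ρ₋·ω·I₋(α)))^{1/N}, R₊(β) = (V₊/(ρ₊·ω·I₊(β)))^{1/N}, and F(α, β) = (N−1)·ρ₋·ω·R₋(α)^{N−1}·J₋(α) + (N−1)·ρ₊·ω·R₊(β)^{N−1}·J₊(β) + γ·ω·|R₋(α)^{N−1}·(sin α)^{N−1} − R₊(β)^{N−1}·(sin β)^{N−1}|. If (α, β) ∈ (0, π)² is a local minimum point of F and R₋(α)·sin α < R₊(β)·sin β, then ρ₋·cos α = −γ and ρ₊·cos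 β = −γ. -/
open Real

noncomputable def Im (N : ℕ) (α : ℝ) : ℝ := ∫ θ in α..π, sin θ ^ N

noncomputable def Jm (N : ℕ) (α : ℝ) : ℝ := ∫ θ in α..π, sin θ ^ (N - 2)

noncomputable def Ip (N : ℕ) (β : ℝ) : ℝ := ∫ θ in (0:ℝ)..β, sin θ ^ N

noncomputable def Jp (N : ℕ) (β : ℝ) : ℝ := ∫ θ in (0:ℝ)..β, sin θ ^ (N - 2)

noncomputable def Rm (N : ℕ) (ρm V ω α : ℝ) : ℝ := (V / (ρm * ω * Im N α)) ^ ((1 : ℝ) / N)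

noncomputable def Rp (N : ℕ) (ρp V ω β : ℝ) : ℝ := (V / (ρp * ω * Ip N β)) ^ ((1 : ℝ) / N)

noncomputable def F (N : ℕ) (ρm ρp Vm Vp ω γ : ℝ) (p : ℝ × ℝ) : ℝ :=
  ((N : ℝ) - 1) * ρm * ω * Rm N ρm Vm ω p.1 ^ (N - 1) * Jm N p.1 +
    ((N : ℝ) - 1) * ρp * ω * Rp N ρp Vp ω p.2 ^ (N - 1) * Jp N p.2 +
    γ * ω * |Rm N ρm Vm ω p.1 ^ (N - 1) * sin p.1 ^ (N - 1) -
      Rp N ρp Vp ω p.2 ^ (N - 1) * sin p.2 ^ (N - 1)|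

open Filter Topology

lemma Ip_eq_Im (N : ℕ) (β : ℝ) : Ip N β = Im N (π - β) := by
  have h := intervalIntegral.integral_comp_sub_left (a := 0) (b := β) (fun x => sin x ^ N) π
  simpa [Ip, Im] using h

lemma Jp_eq_Jm (N : ℕ) (β : ℝ) : Jp N β = Jm N (π - β) := by
  have h := intervalIntegral.integral_comp_sub_left (a := 0) (b := β) (fun x => sin x ^ (N - 2)) π
  simpa [Jp, Jm] using h

lemma Rp_eq_Rm (N : ℕ) (ρ V ω β : ℝ) : Rp N ρ V ω β = Rm N ρ V ω (π - β) := by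
  simp only [Rp, Rm, Ip_eq_Im]

lemma hasDerivAt_integral_sin_pow (n : ℕ) (a : ℝ) :
    HasDerivAt (fun t => ∫ θ in t..π, sin θ ^ n) (-(sin a ^ n)) a := by
  have hc : Continuous fun θ : ℝ => sin θ ^ n := by fun_prop
  exact intervalIntegral.integral_hasDerivAt_left (hc.intervalIntegrable _ _)
    (hc.stronglyMeasurableAtFilter _ _) hc.continuousAt

lemma integral_sin_pow_to_pi_pos (n : ℕ) {a : ℝ} (ha : a ∈ Set.Ioo 0 π) :
    0 < ∫ θ in a..π, sin θ ^ n := by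
  have hc : Continuous fun θ : ℝ => sin θ ^ n := by fun_prop
  exact intervalIntegral.intervalIntegral_pos_of_pos_on (hc.intervalIntegrable _ _)
    (fun x hx => pow_pos (sin_pos_of_pos_of_lt_pi (ha.1.trans hx.1) hx.2) n) ha.2

lemma integral_sin_pow_mul_cos_add_pos (n : ℕ) {a : ℝ} (ha : a ∈ Set.Ioo 0 π) :
    0 < sin a ^ (n + 1) + (n + 1) * (∫ θ in a..π, sin θ ^ n) * cos a := by
  have h1 : ∫ θ in a..π, (n + 1) * sin θ ^ n * cos θ = 0 - sin a ^ (n + 1) := by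
    have hd : ∀ x ∈ Set.uIcc a π,
        HasDerivAt (fun x => sin x ^ (n + 1)) ((n + 1) * sin x ^ n * cos x) x := fun x _ => by
      simpa using (hasDerivAt_sin x).fun_pow (n + 1)
    have hc : Continuous fun θ : ℝ => (n + 1) * sin θ ^ n * cos θ := by fun_prop
    rw [intervalIntegral.integral_eq_sub_of_hasDerivAt hd (hc.intervalIntegrable _ _)]
    simp
  have hc : Continuous fun θ : ℝ => (n + 1) * sin θ ^ n * cos a - (n + 1) * sin θ ^ n * cos θ := by
    fun_prop
  have h2 : 0 < ∫ θ in a..π, ((n + 1) * sin θ ^ n * cos a - (n + 1) * sin θ ^ n * cos θ) := by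
    refine intervalIntegral.intervalIntegral_pos_of_pos_on (hc.intervalIntegrable _ _)
      (fun x hx => ?_) ha.2
    have hs := pow_pos (sin_pos_of_pos_of_lt_pi (ha.1.trans hx.1) hx.2) n
    have hcos : cos x < cos a := cos_lt_cos_of_nonneg_of_le_pi ha.1.le hx.2.le hx.1
    rw [← mul_sub]
    exact mul_pos (by positivity) (sub_pos.2 hcos)
  rw [intervalIntegral.integral_sub (Continuous.intervalIntegrable (by fun_prop) _ _)
    (Continuous.intervalIntegrable (by fun_prop) _ _), h1, intervalIntegral.integral_mul_const,
    intervalIntegral.integral_const_mul] at h2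
  linarith

lemma Rm_pos (N : ℕ) {ρ V ω a : ℝ} (hρ : 0 < ρ) (hV : 0 < V) (hω : 0 < ω)
    (ha : a ∈ Set.Ioo 0 π) : 0 < Rm N ρ V ω a := by
  have hI : 0 < Im N a := integral_sin_pow_to_pi_pos N ha
  unfold Rm
  positivity

lemma hasDerivAt_Rm (N : ℕ) {ρ V ω a : ℝ} (hρ : 0 < ρ) (hV : 0 < V) (hω : 0 < ω)
    (ha : a ∈ Set.Ioo 0 π) :
    HasDerivAt (Rm N ρ V ω) (Rm N ρ V ω a * sin a ^ N / (N * Im N a)) a := by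
  have hI : 0 < Im N a := integral_sin_pow_to_pi_pos N ha
  have hd : HasDerivAt (Im N) (-(sin a ^ N)) a := hasDerivAt_integral_sin_pow N a
  have hq := ((hasDerivAt_const a V).div (hd.const_mul (ρ * ω)) (by positivity)).rpow_const
    (p := (1 : ℝ) / N) (Or.inl (by simp only [Pi.div_apply]; positivity))
  refine hq.congr_deriv ?_
  simp only [Pi.div_apply, Rm]
  rw [rpow_sub_one (by positivity)]
  generalize (V / (ρ * ω * Im N a)) ^ ((1 : ℝ) / N) = r
  rcases eq_or_ne (N : ℝ) 0 with h | h
  · simp [h]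
  · field_simp
    ring

/-- Critical points of the weighted perimeter of one cap, as a function of its angle. -/
lemma mul_cos_eq_of_isLocalMin {N : ℕ} (hN : 2 ≤ N) {ρ V ω γ a : ℝ} (hρ : 0 < ρ) (hV : 0 < V)
    (hω : 0 < ω) (ha : a ∈ Set.Ioo 0 π)
    (hmin : IsLocalMin (fun t => ((N : ℝ) - 1) * ρ * ω * Rm N ρ V ω t ^ (N - 1) * Jm N t -
      γ * ω * (Rm N ρ V ω t ^ (N - 1) * sin t ^ (N - 1))) a) :
    ρ * cos a = -γ := by
  obtain ⟨n, rfl⟩ := Nat.exists_eq_add_of_le' hN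
  have hR := hasDerivAt_Rm (n + 2) hρ hV hω ha
  have hRpos := Rm_pos (n + 2) hρ hV hω ha
  have hI : 0 < Im (n + 2) a := integral_sin_pow_to_pi_pos _ ha
  have hs : 0 < sin a := sin_pos_of_pos_of_lt_pi ha.1 ha.2
  have hJ : HasDerivAt (Jm (n + 2)) (-(sin a ^ n)) a := hasDerivAt_integral_sin_pow n a
  have hrec : (n + 2) * Im (n + 2) a = sin a ^ (n + 1) * cos a + (n + 1) * Jm (n + 2) a := by
    simp only [Im, Jm, integral_sin_pow, Nat.add_sub_cancel]
    field_simp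
    simp
  have hpos : 0 < sin a ^ (n + 1) + (n + 1) * Jm (n + 2) a * cos a :=
    integral_sin_pow_mul_cos_add_pos n ha
  have hd := (((hR.pow (n + 1)).const_mul (((n + 2 : ℕ) - 1 : ℝ) * ρ * ω)).mul hJ).sub
    (((hR.pow (n + 1)).mul ((hasDerivAt_sin a).pow (n + 1))).const_mul (γ * ω))
  have h0 := hmin.hasDerivAt_eq_zero hd
  have hcs := sin_sq_add_cos_sq a
  simp only [Pi.pow_apply, Nat.add_sub_cancel] at h0
  push_cast at h0
  set r := Rm (n + 2) ρ V ω a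
  set I := Im (n + 2) a
  set J := Jm (n + 2) a
  have h1 : (n + 1) * ω * r ^ (n + 1) * sin a ^ n * (sin a ^ 2 * ((n + 1) * ρ * J -
      γ * sin a ^ (n + 1)) - (n + 2) * I * (ρ + γ * cos a)) = 0 := by
    rw [← mul_zero ((n + 2) * I), ← h0]
    field_simp
    ring
  have h2 := (mul_eq_zero.1 h1).resolve_left (by positivity)
  have h3 : (ρ * cos a + γ) * (sin a ^ (n + 1) + (n + 1) * J * cos a) = 0 := by
    rw [hrec] at h2
    linear_combination -h2 + ((n + 1) * ρ * J - γ * sin a ^ (n + 1)) * hcs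
  linarith [(mul_eq_zero.1 h3).resolve_right hpos.ne']

theorem stmt_13 (N : ℕ) (hN : 2 ≤ N) (ρm ρp Vm Vp ω γ : ℝ)
    (hρm : 0 < ρm) (hρp : 0 < ρp) (hVm : 0 < Vm) (hVp : 0 < Vp) (hω : 0 < ω) (hγ : 0 < γ)
    (α β : ℝ) (hαβ : (α, β) ∈ Set.Ioo (0:ℝ) π ×ˢ Set.Ioo (0:ℝ) π)
    (hmin : IsLocalMinOn (F N ρm ρp Vm Vp ω γ) (Set.Ioo (0:ℝ) π ×ˢ Set.Ioo (0:ℝ) π) (α, β))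
    (hlt : Rm N ρm Vm ω α * sin α < Rp N ρp Vp ω β * sin β) :
    ρm * cos α = -γ ∧ ρp * cos β = -γ := by
  have hα : α ∈ Set.Ioo 0 π := hαβ.1
  have hβ : π - β ∈ Set.Ioo 0 π := ⟨by linarith [hαβ.2.2], by linarith [hαβ.2.1]⟩
  have hF : IsLocalMin (F N ρm ρp Vm Vp ω γ) (α, β) :=
    hmin.isLocalMin ((isOpen_Ioo.prod isOpen_Ioo).mem_nhds hαβ)
  have hRm : ContinuousAt (Rm N ρm Vm ω) α := (hasDerivAt_Rm N hρm hVm hω hα).continuousAt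
  have hRp : ContinuousAt (Rm N ρp Vp ω) (π - β) := (hasDerivAt_Rm N hρp hVp hω hβ).continuousAt
  have hpow : Rm N ρm Vm ω α ^ (N - 1) * sin α ^ (N - 1) <
      Rm N ρp Vp ω (π - β) ^ (N - 1) * sin (π - β) ^ (N - 1) := by
    rw [← mul_pow, ← mul_pow, sin_pi_sub, ← Rp_eq_Rm]
    exact pow_lt_pow_left₀ hlt (mul_nonneg (Rm_pos N hρm hVm hω hα).le
      (sin_pos_of_pos_of_lt_pi hα.1 hα.2).le) (by omega)
  have hFeq : ∀ x y, Rm N ρm Vm ω x ^ (N - 1) * sin x ^ (N - 1) <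
      Rm N ρp Vp ω y ^ (N - 1) * sin y ^ (N - 1) → F N ρm ρp Vm Vp ω γ (x, π - y) =
      (((N : ℝ) - 1) * ρm * ω * Rm N ρm Vm ω x ^ (N - 1) * Jm N x -
        γ * ω * (Rm N ρm Vm ω x ^ (N - 1) * sin x ^ (N - 1))) +
      (((N : ℝ) - 1) * ρp * ω * Rm N ρp Vp ω y ^ (N - 1) * Jm N y -
        (-γ) * ω * (Rm N ρp Vp ω y ^ (N - 1) * sin y ^ (N - 1))) := by
    intro x y hxy
    simp only [F, Rp_eq_Rm, Jp_eq_Jm, sub_sub_cancel, sin_pi_sub]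
    rw [abs_of_neg (sub_neg.2 hxy)]
    ring
  have hFα := hFeq α (π - β) hpow
  rw [sub_sub_cancel] at hFα
  constructor
  · refine mul_cos_eq_of_isLocalMin hN hρm hVm hω hα ?_
    have ht : Tendsto (fun x : ℝ => (x, β)) (𝓝 α) (𝓝 (α, β)) :=
      Continuous.tendsto (by fun_prop) α
    have hc : ContinuousAt (fun x => Rm N ρm Vm ω x ^ (N - 1) * sin x ^ (N - 1)) α :=
      (hRm.pow _).mul (continuous_sin.continuousAt.pow _)
    filter_upwards [ht.eventually hF, hc.eventually_lt_const hpow] with x hx hlx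
    have hFx := hFeq x (π - β) hlx
    rw [sub_sub_cancel] at hFx
    linarith
  · have key : ρp * cos (π - β) = - -γ := by
      refine mul_cos_eq_of_isLocalMin hN hρp hVp hω hβ ?_
      have ht : Tendsto (fun y : ℝ => (α, π - y)) (𝓝 (π - β)) (𝓝 (α, β)) := by
        have h : Continuous (fun y : ℝ => (α, π - y)) := by fun_prop
        simpa using h.tendsto (π - β)
      have hc : ContinuousAt (fun y => Rm N ρp Vp ω y ^ (N - 1) * sin y ^ (N - 1)) (π - β) :=
        (hRp.pow _).mul (continuous_sin.continuousAt.pow _)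
      filter_upwards [ht.eventually hF, hc.eventually_const_lt hpow] with y hy hly
      have hFy := hFeq α y hly
      linarith
    rw [cos_pi_sub] at key
    linarith
end

section
/- Let N ≥ 2 be an integer and ρ₋, ρ₊, V₋, V₊, ω > 0, and set m = min(ρ₋, ρ₊). Define, for γ ∈ (−m, m), L(γ) = (V₋/(ω·ρ₋)) · (sin α(γ))^N / I₋(α(γ)) − (V₊/(ω·ρ₊)) · (sin β(γ))^N / I₊(β(γ)), where α(γ) = arccos(γ/ρ₋), β(γ) = arccos(γ/ρ₊), I₋(α) = ∫_α^π (sin θ)^N dθ and I₊(β) = ∫_0^β (sin θ)^N dθ. Then L is strictly decreasing on (−m, m) and there exists a unique γ⋆ ∈ (−m, m) with L(γ⋆) = 0. -/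
open Real

noncomputable def L (N : ℕ) (ρm ρp Vm Vp ω γ : ℝ) : ℝ :=
  Vm / (ω * ρm) * (sin (arccos (γ / ρm)) ^ N / Im N (arccos (γ / ρm))) -
    Vp / (ω * ρp) * (sin (arccos (γ / ρp)) ^ N / Ip N (arccos (γ / ρp)))

theorem hasDerivAt_Ip (N : ℕ) (x : ℝ) : HasDerivAt (Ip N) (sin x ^ N) x := by
  have hc : Continuous fun θ : ℝ => sin θ ^ N := by fun_prop
  exact intervalIntegral.integral_hasDerivAt_right (hc.intervalIntegrable _ _)
    (hc.stronglyMeasurableAtFilter _ _) hc.continuousAt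

theorem continuous_Ip (N : ℕ) : Continuous (Ip N) :=
  continuous_iff_continuousAt.2 fun x => (hasDerivAt_Ip N x).continuousAt

theorem Ip_pos (N : ℕ) {x : ℝ} (h0 : 0 < x) (hx : x ≤ π) : 0 < Ip N x := by
  have hc : Continuous fun θ : ℝ => sin θ ^ N := by fun_prop
  refine intervalIntegral.intervalIntegral_pos_of_pos_on (hc.intervalIntegrable _ _) ?_ h0
  intro θ hθ
  exact pow_pos (sin_pos_of_pos_of_lt_pi hθ.1 (hθ.2.trans_le hx)) N

theorem Im_eq_Ip (N : ℕ) (α : ℝ) : Im N α = Ip N (π - α) := by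
  have h := intervalIntegral.integral_comp_sub_left (fun θ : ℝ => sin θ ^ N) (a := α) (b := π) π
  simpa [Im, Ip, sin_pi_sub] using h

theorem mul_cos_mul_Ip_lt (N : ℕ) {x : ℝ} (h0 : 0 < x) (hx : x < π) :
    N * cos x * Ip N x < sin x ^ (N + 1) := by
  rcases le_or_gt (π / 2) x with h | h
  · have hcos : cos x ≤ 0 := cos_nonpos_of_pi_div_two_le_of_le h (by linarith)
    have hI := Ip_pos N h0 hx.le
    have hs : 0 < sin x ^ (N + 1) := pow_pos (sin_pos_of_pos_of_lt_pi h0 hx) _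
    have : N * cos x ≤ 0 := mul_nonpos_of_nonneg_of_nonpos N.cast_nonneg hcos
    nlinarith
  · have hd : ∀ y, HasDerivAt (fun y => sin y ^ (N + 1) - N * cos y * Ip N y)
        (sin y ^ N * cos y + N * sin y * Ip N y) y := by
      intro y
      refine (((hasDerivAt_sin y).fun_pow (N + 1)).fun_sub
        (((hasDerivAt_cos y).const_mul (N : ℝ)).fun_mul (hasDerivAt_Ip N y))).congr_deriv ?_
      rw [Nat.add_sub_cancel]
      push_cast
      ring
    have hm : StrictMonoOn (fun y => sin y ^ (N + 1) - N * cos y * Ip N y)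
        (Set.Icc 0 (π / 2)) := by
      refine strictMonoOn_of_deriv_pos (convex_Icc _ _)
        (fun y _ => (hd y).continuousAt.continuousWithinAt) fun y hy => ?_
      rw [interior_Icc] at hy
      rw [(hd y).deriv]
      have hs : 0 < sin y := sin_pos_of_pos_of_lt_pi hy.1 (by linarith [hy.2, pi_pos])
      have hcos : 0 < cos y := cos_pos_of_mem_Ioo ⟨by linarith [hy.1, pi_pos], hy.2⟩
      have hI := Ip_pos N hy.1 (by linarith [hy.2, pi_pos])
      positivity
    have := hm ⟨le_rfl, by positivity⟩ ⟨h0.le, h.le⟩ h0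
    simpa [Ip] using this

/-- The ratio of `sin x ^ N` to the cap integral `Ip N x`. -/
noncomputable def capRatio (N : ℕ) (x : ℝ) : ℝ := sin x ^ N / Ip N x

theorem capRatio_pos (N : ℕ) {x : ℝ} (h0 : 0 < x) (hx : x < π) : 0 < capRatio N x :=
  div_pos (pow_pos (sin_pos_of_pos_of_lt_pi h0 hx) N) (Ip_pos N h0 hx.le)

theorem continuousAt_capRatio (N : ℕ) {x : ℝ} (h0 : 0 < x) (hx : x ≤ π) :
    ContinuousAt (capRatio N) x :=
  ContinuousAt.div (by fun_prop) (continuous_Ip N).continuousAt (Ip_pos N h0 hx).ne'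

theorem capRatio_strictAntiOn {N : ℕ} (hN : N ≠ 0) :
    StrictAntiOn (capRatio N) (Set.Ioo 0 π) := by
  refine strictAntiOn_of_deriv_neg (convex_Ioo _ _)
    (fun x hx => (continuousAt_capRatio N hx.1 hx.2.le).continuousWithinAt) fun x hx => ?_
  rw [interior_Ioo] at hx
  have hI := Ip_pos N hx.1 hx.2.le
  have hs := sin_pos_of_pos_of_lt_pi hx.1 hx.2
  have hd : HasDerivAt (capRatio N) _ x :=
    ((hasDerivAt_sin x).fun_pow N).fun_div (hasDerivAt_Ip N x) hI.ne'
  rw [hd.deriv]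
  refine div_neg_of_neg_of_pos ?_ (by positivity)
  obtain ⟨k, rfl⟩ := Nat.exists_eq_succ_of_ne_zero hN
  have h := mul_lt_mul_of_pos_left (mul_cos_mul_Ip_lt (k + 1) hx.1 hx.2) (pow_pos hs k)
  simp only [Nat.succ_eq_add_one, Nat.add_sub_cancel] at h hI ⊢
  rw [sub_neg]
  calc _ = sin x ^ k * (((k + 1 : ℕ) : ℝ) * cos x * Ip (k + 1) x) := by ring
    _ < _ := h
    _ = _ := by ring

theorem inv_le_capRatio (N : ℕ) {x : ℝ} (h0 : 0 < x) (hx : x ≤ π / 2) :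
    x⁻¹ ≤ capRatio N x := by
  have hI := Ip_pos N h0 (by linarith [pi_pos])
  have hc : Continuous fun θ : ℝ => sin θ ^ N := by fun_prop
  have hle : Ip N x ≤ ∫ _ in (0:ℝ)..x, sin x ^ N := by
    refine intervalIntegral.integral_mono_on h0.le (hc.intervalIntegrable _ _)
      intervalIntegrable_const fun θ hθ => ?_
    exact pow_le_pow_left₀ (sin_nonneg_of_nonneg_of_le_pi hθ.1 (by linarith [hθ.2, pi_pos]))
      (sin_le_sin_of_le_of_le_pi_div_two (by linarith [hθ.1, pi_pos]) hx hθ.2) N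
  rw [intervalIntegral.integral_const, sub_zero, smul_eq_mul] at hle
  rw [capRatio, le_div_iff₀ hI, inv_mul_le_iff₀ h0]
  exact hle

theorem arccos_mem_Ioo {t : ℝ} (ht : t ∈ Set.Ioo (-1 : ℝ) 1) : arccos t ∈ Set.Ioo 0 π := by
  refine ⟨arccos_pos.2 ht.2, lt_of_le_of_ne (arccos_le_pi t) fun h => ?_⟩
  exact absurd (arccos_eq_pi.1 h) (not_le.2 ht.1)

theorem capRatio_arccos_strictMonoOn {N : ℕ} (hN : N ≠ 0) :
    StrictMonoOn (fun t => capRatio N (arccos t)) (Set.Ioo (-1) 1) := fun _ hs _ ht hst =>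
  capRatio_strictAntiOn hN (arccos_mem_Ioo ht) (arccos_mem_Ioo hs)
    (strictAntiOn_arccos (Set.Ioo_subset_Icc_self hs) (Set.Ioo_subset_Icc_self ht) hst)

theorem exists_lt_capRatio_arccos (N : ℕ) (M : ℝ) :
    ∃ t ∈ Set.Ioo (0 : ℝ) 1, M < capRatio N (arccos t) := by
  have hp := pi_gt_three
  set x : ℝ := (|M| + 1)⁻¹ with hx
  have hM := abs_nonneg M
  have h0 : 0 < x := by positivity
  have h1 : x ≤ 1 := inv_le_one_of_one_le₀ (by linarith)
  refine ⟨cos x, ⟨cos_pos_of_mem_Ioo ⟨by linarith, by linarith⟩, ?_⟩, ?_⟩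
  · rw [← cos_zero]
    exact cos_lt_cos_of_nonneg_of_le_pi le_rfl (by linarith) h0
  · rw [arccos_cos h0.le (by linarith)]
    have h := inv_le_capRatio N h0 (by linarith)
    rw [hx, inv_inv, ← hx] at h
    linarith [le_abs_self M]

theorem exists_capRatio_arccos_neg_lt {N : ℕ} (hN : N ≠ 0) {ε : ℝ} (hε : 0 < ε) :
    ∃ t ∈ Set.Ioo (0 : ℝ) 1, capRatio N (arccos (-t)) < ε := by
  have hp := pi_pos
  have hlt : capRatio N π < ε := by simpa [capRatio, hN] using hε
  have hev := ((continuousAt_capRatio N hp le_rfl).eventually_lt_const hlt).filter_mono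
    (nhdsWithin_le_nhds (s := Set.Iio π))
  obtain ⟨x, hx, hx1, hx2⟩ := (hev.and (Ioo_mem_nhdsLT (show π / 2 < π by linarith))).exists
  refine ⟨-cos x, ⟨?_, ?_⟩, ?_⟩
  · linarith [cos_neg_of_pi_div_two_lt_of_lt hx1 (by linarith)]
  · have := cos_lt_cos_of_nonneg_of_le_pi (by linarith) le_rfl hx2
    rw [cos_pi] at this
    linarith
  · rwa [neg_neg, arccos_cos (by linarith) hx2.le]

theorem div_mem_Ioo {γ a b : ℝ} (ha : 0 < a) (hab : b ≤ a) (hγ : γ ∈ Set.Ioo (-b) b) :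
    γ / a ∈ Set.Ioo (-1 : ℝ) 1 :=
  ⟨by rw [lt_div_iff₀ ha]; linarith [hγ.1], by rw [div_lt_iff₀ ha]; linarith [hγ.2]⟩

theorem exists_mul_capRatio_lt {N : ℕ} (hN : N ≠ 0) {a b A B : ℝ} (ha : 0 < a) (hb : 0 < b)
    (hA : 0 < A) (hB : 0 < B) :
    ∃ γ ∈ Set.Ioo 0 (min a b),
      A * capRatio N (arccos (-γ / a)) < B * capRatio N (arccos (γ / b)) := by
  have hmono := (capRatio_arccos_strictMonoOn hN).monotoneOn
  have hz : (0 : ℝ) ∈ Set.Ioo (-1 : ℝ) 1 := by norm_num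
  set c := capRatio N (arccos 0) with hc
  have hc0 : 0 < c := capRatio_pos N (arccos_mem_Ioo hz).1 (arccos_mem_Ioo hz).2
  rcases le_total a b with h | h
  · obtain ⟨t, ht, hlt⟩ := exists_capRatio_arccos_neg_lt hN (show 0 < B * c / A by positivity)
    have hγ : a * t ∈ Set.Ioo 0 a := ⟨mul_pos ha ht.1, by nlinarith [ht.2]⟩
    refine ⟨a * t, by rwa [min_eq_left h], ?_⟩
    have e : -(a * t) / a = -t := by field_simp
    have hle : c ≤ capRatio N (arccos (a * t / b)) :=
      hmono hz (div_mem_Ioo hb h ⟨by linarith [hγ.1], hγ.2⟩) (div_pos hγ.1 hb).le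
    rw [e]
    rw [lt_div_iff₀ hA] at hlt
    nlinarith [mul_le_mul_of_nonneg_left hle hB.le]
  · obtain ⟨t, ht, hlt⟩ := exists_lt_capRatio_arccos N (A * c / B)
    have hγ : b * t ∈ Set.Ioo 0 b := ⟨mul_pos hb ht.1, by nlinarith [ht.2]⟩
    refine ⟨b * t, by rwa [min_eq_right h], ?_⟩
    have e : b * t / b = t := by field_simp
    have hle : capRatio N (arccos (-(b * t) / a)) ≤ c :=
      hmono (div_mem_Ioo ha h ⟨by linarith [hγ.2], by linarith [hγ.1]⟩) hz
        (div_neg_of_neg_of_pos (by linarith [hγ.1]) ha).le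
    rw [e]
    rw [div_lt_iff₀ hB] at hlt
    nlinarith [mul_le_mul_of_nonneg_left hle hA.le]

theorem L_eq_capRatio (N : ℕ) (ρm ρp Vm Vp ω γ : ℝ) :
    L N ρm ρp Vm Vp ω γ = Vm / (ω * ρm) * capRatio N (arccos (-γ / ρm)) -
      Vp / (ω * ρp) * capRatio N (arccos (γ / ρp)) := by
  rw [L, capRatio, capRatio, Im_eq_Ip, neg_div, arccos_neg, sin_pi_sub]

theorem stmt_14 (N : ℕ) (hN : 2 ≤ N) (ρm ρp Vm Vp ω : ℝ)
    (hρm : 0 < ρm) (hρp : 0 < ρp) (hVm : 0 < Vm) (hVp : 0 < Vp) (hω : 0 < ω) :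
    StrictAntiOn (L N ρm ρp Vm Vp ω) (Set.Ioo (-(min ρm ρp)) (min ρm ρp)) ∧
      ∃! γstar : ℝ, γstar ∈ Set.Ioo (-(min ρm ρp)) (min ρm ρp) ∧
        L N ρm ρp Vm Vp ω γstar = 0 := by
  have hN0 : N ≠ 0 := by lia
  set m := min ρm ρp with hm
  have hA : 0 < Vm / (ω * ρm) := by positivity
  have hB : 0 < Vp / (ω * ρp) := by positivity
  have hneg : ∀ γ ∈ Set.Ioo (-m) m, -γ / ρm ∈ Set.Ioo (-1 : ℝ) 1 := fun γ hγ =>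
    div_mem_Ioo hρm (min_le_left _ _) ⟨by linarith [hγ.2], by linarith [hγ.1]⟩
  have hpos : ∀ γ ∈ Set.Ioo (-m) m, γ / ρp ∈ Set.Ioo (-1 : ℝ) 1 := fun γ hγ =>
    div_mem_Ioo hρp (min_le_right _ _) hγ
  have hmono := capRatio_arccos_strictMonoOn hN0
  have hanti : StrictAntiOn (L N ρm ρp Vm Vp ω) (Set.Ioo (-m) m) := by
    intro x hx y hy hxy
    have h1 : capRatio N (arccos (-y / ρm)) < capRatio N (arccos (-x / ρm)) :=
      hmono (hneg y hy) (hneg x hx) (div_lt_div_of_pos_right (neg_lt_neg hxy) hρm)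
    have h2 : capRatio N (arccos (x / ρp)) < capRatio N (arccos (y / ρp)) :=
      hmono (hpos x hx) (hpos y hy) (div_lt_div_of_pos_right hxy hρp)
    rw [L_eq_capRatio, L_eq_capRatio]
    linarith [mul_lt_mul_of_pos_left h1 hA, mul_lt_mul_of_pos_left h2 hB]
  have hcomp : ∀ t ∈ Set.Ioo (-1 : ℝ) 1, ContinuousAt (fun t => capRatio N (arccos t)) t :=
    fun t ht => ContinuousAt.comp (f := arccos) (continuousAt_capRatio N (arccos_mem_Ioo ht).1
      (arccos_mem_Ioo ht).2.le) continuous_arccos.continuousAt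
  have hcont : ContinuousOn (L N ρm ρp Vm Vp ω) (Set.Ioo (-m) m) := by
    rw [funext (L_eq_capRatio N ρm ρp Vm Vp ω)]
    intro γ hγ
    refine ContinuousAt.continuousWithinAt (ContinuousAt.sub ?_ ?_)
    · exact continuousAt_const.mul (ContinuousAt.comp (f := fun γ => -γ / ρm)
        (hcomp _ (hneg γ hγ)) (by fun_prop))
    · exact continuousAt_const.mul (ContinuousAt.comp (f := fun γ => γ / ρp)
        (hcomp _ (hpos γ hγ)) (by fun_prop))
  obtain ⟨x, hx, hLx⟩ := exists_mul_capRatio_lt hN0 hρm hρp hA hB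
  obtain ⟨y, hy, hLy⟩ := exists_mul_capRatio_lt hN0 hρp hρm hB hA
  rw [min_comm, ← hm] at hy
  rw [← hm] at hx
  have hx' : x ∈ Set.Ioo (-m) m := ⟨by linarith [hx.1, hx.2], hx.2⟩
  have hy' : -y ∈ Set.Ioo (-m) m := ⟨by linarith [hy.2], by linarith [hy.1, hy.2]⟩
  obtain ⟨z, hz, hLz⟩ := isPreconnected_Ioo.intermediate_value hx' hy' hcont
    (show (0 : ℝ) ∈ Set.Icc _ _ by
      rw [L_eq_capRatio, L_eq_capRatio, neg_neg]
      exact ⟨by linarith, by linarith⟩)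
  refine ⟨hanti, z, ⟨hz, hLz⟩, fun w hw => hanti.injOn hw.1 hz (hw.2.trans hLz.symm)⟩
end
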